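/- Let 𝒞 be a set of cost functions that is closed under composition and consistent for weighted resource graph games. Then for every c ∈ 𝒞 with c : ℝ_{≥0}^m → ℝ^m, for all r, s ∈ {1,…,m} with r ≠ s, all x, y ∈ ℝ_{≥0}^m with x_r > 0 and y_r > 0, and all ε > 0, it holds that c_r(x + ε·1_s) − c_r(x) = c_r(y + ε·1_s) − c_r(y). -/

import Mathlib

open Finset NNReal

/-- The indicator vector of a set `S` of resources, as a vector of nonnegative reals. -/
def nindicVec {m : ℕ} (S : Finset (Fin m)) : Fin m → NNReal :=
  fun r => if r ∈ S then 1 else 0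

/-- The load vector induced by weights `w` and a profile `y` of `0/1`-vectors. -/
def wloadVec {n m : ℕ} (w : Fin n → NNReal) (y : Fin n → Fin m → ℕ) : Fin m → NNReal :=
  fun r => ∑ i, w i * (y i r : NNReal)

/-- The private cost of player `i` in the weighted resource graph game. -/
noncomputable def wPlayerCost {n m : ℕ} (c : (Fin m → NNReal) → Fin m → ℝ)
    (w : Fin n → NNReal) (y : Fin n → Fin m → ℕ) (i : Fin n) : ℝ :=
  ∑ r, ((w i : ℝ) * (y i r : ℝ)) * c (wloadVec w y) r

/-- `Y` is a valid system of strategy sets: each `Y i` is a nonempty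
finite set of `0/1`-vectors. -/
def IsStrategySets {n m : ℕ} (Y : Fin n → Finset (Fin m → ℕ)) : Prop :=
  (∀ i, (Y i).Nonempty) ∧ ∀ i, ∀ v ∈ Y i, ∀ r, v r ≤ 1

/-- `y` is a pure Nash equilibrium of the weighted resource graph game with
weights `w`, strategy sets `Y`, and cost function `c`. -/
def IsWPNE {n m : ℕ} (c : (Fin m → NNReal) → Fin m → ℝ) (w : Fin n → NNReal)
    (Y : Fin n → Finset (Fin m → ℕ)) (y : Fin n → Fin m → ℕ) : Prop :=
  (∀ i, y i ∈ Y i) ∧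
    ∀ i, ∀ y' ∈ Y i,
      wPlayerCost c w y i ≤ wPlayerCost c w (Function.update y i y') i

/-- The composition `c ⊕ c'` of two cost functions. -/
def woplus {m m' : ℕ} (c : (Fin m → NNReal) → Fin m → ℝ)
    (c' : (Fin m' → NNReal) → Fin m' → ℝ) :
    (Fin (m + m') → NNReal) → Fin (m + m') → ℝ :=
  fun x => Fin.addCases (motive := fun _ => ℝ)
    (fun i => c (fun j => x (Fin.castAdd m' j)) i)
    (fun i => c' (fun j => x (Fin.natAdd m j)) i)

/-- A set of cost functions on the nonnegative orthant, one set for each number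
`m` of resources. -/
abbrev WCostFamily := (m : ℕ) → Set ((Fin m → NNReal) → Fin m → ℝ)

/-- `𝒞` is closed under composition. -/
def WClosedUnderComposition (𝒞 : WCostFamily) : Prop :=
  ∀ m m' : ℕ, ∀ c ∈ 𝒞 m, ∀ c' ∈ 𝒞 m', woplus c c' ∈ 𝒞 (m + m')

/-- `𝒞` is consistent for weighted resource graph games: every weighted resource
graph game whose cost function belongs to `𝒞` has a pure Nash equilibrium. -/
def WConsistent (𝒞 : WCostFamily) : Prop :=
  ∀ m : ℕ, ∀ c ∈ 𝒞 m, ∀ n : ℕ, ∀ w : Fin n → NNReal, (∀ i, 0 < w i) →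
    ∀ Y : Fin n → Finset (Fin m → ℕ), IsStrategySets Y →
      ∃ y, IsWPNE c w Y y

/-- The load that a player of weight `w` puts on the resources by playing the vector `z`. -/
def strategyLoad {m : ℕ} (w : NNReal) (z : Fin m → ℕ) : Fin m → NNReal :=
  fun r => w * (z r : NNReal)

/-- The private cost of a player of weight `w` playing `z` under the total load `u`. -/
noncomputable def strategyCost {m : ℕ} (c : (Fin m → NNReal) → Fin m → ℝ) (w : NNReal)
    (z : Fin m → ℕ) (u : Fin m → NNReal) : ℝ :=
  ∑ r, ((w : ℝ) * (z r : ℝ)) * c u r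

lemma strategyLoad_zero {m : ℕ} (w : NNReal) : strategyLoad w (0 : Fin m → ℕ) = 0 := by
  ext r; simp [strategyLoad]

lemma strategyLoad_single {m : ℕ} (w : NNReal) (r : Fin m) :
    strategyLoad w (Pi.single r 1) = Pi.single r w := by
  ext k
  by_cases h : k = r
  · subst h; simp [strategyLoad]
  · simp [strategyLoad, h]

lemma strategyLoad_add {m : ℕ} (w : NNReal) (z z' : Fin m → ℕ) :
    strategyLoad w (z + z') = strategyLoad w z + strategyLoad w z' := by
  ext r; simp [strategyLoad, mul_add]

lemma strategyLoad_append {m m' : ℕ} (w : NNReal) (z : Fin m → ℕ) (z' : Fin m' → ℕ) :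
    strategyLoad w (Fin.append z z') = Fin.append (strategyLoad w z) (strategyLoad w z') := by
  ext r
  refine Fin.addCases (fun k => ?_) (fun k => ?_) r <;> simp [strategyLoad]

lemma strategyCost_zero {m : ℕ} (c : (Fin m → NNReal) → Fin m → ℝ) (w : NNReal)
    (u : Fin m → NNReal) : strategyCost c w 0 u = 0 := by
  simp [strategyCost]

lemma strategyCost_single {m : ℕ} (c : (Fin m → NNReal) → Fin m → ℝ) (w : NNReal) (r : Fin m)
    (u : Fin m → NNReal) : strategyCost c w (Pi.single r 1) u = w * c u r := by
  unfold strategyCost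
  rw [Finset.sum_eq_single r]
  · simp
  · intro k _ hk; simp [hk]
  · simp

lemma strategyCost_add {m : ℕ} (c : (Fin m → NNReal) → Fin m → ℝ) (w : NNReal)
    (z z' : Fin m → ℕ) (u : Fin m → NNReal) :
    strategyCost c w (z + z') u = strategyCost c w z u + strategyCost c w z' u := by
  simp only [strategyCost, Pi.add_apply, Nat.cast_add, ← Finset.sum_add_distrib]
  exact Finset.sum_congr rfl fun r _ => by ring

lemma strategyCost_append {m m' : ℕ} (c : (Fin m → NNReal) → Fin m → ℝ)
    (c' : (Fin m' → NNReal) → Fin m' → ℝ) (w : NNReal) (z : Fin m → ℕ) (z' : Fin m' → ℕ)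
    (u : Fin m → NNReal) (u' : Fin m' → NNReal) :
    strategyCost (woplus c c') w (Fin.append z z') (Fin.append u u') =
      strategyCost c w z u + strategyCost c' w z' u' := by
  simp [strategyCost, woplus, Fin.sum_univ_add]

lemma single_one_le_one {m : ℕ} (k l : Fin m) : (Pi.single k 1 : Fin m → ℕ) l ≤ 1 := by
  by_cases h : l = k <;> simp [h]

lemma append_le_one {m m' : ℕ} {z : Fin m → ℕ} {z' : Fin m' → ℕ} (hz : ∀ r, z r ≤ 1)
    (hz' : ∀ r, z' r ≤ 1) (r : Fin (m + m')) : Fin.append z z' r ≤ 1 := by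
  refine Fin.addCases (fun k => ?_) (fun k => ?_) r
  · simpa only [Fin.append_left] using hz k
  · simpa only [Fin.append_right] using hz' k

lemma append_add_append {m m' : ℕ} (u v : Fin m → NNReal) (u' v' : Fin m' → NNReal) :
    Fin.append u u' + Fin.append v v' = Fin.append (u + v) (u' + v') := by
  ext r
  refine Fin.addCases (fun k => ?_) (fun k => ?_) r <;> simp

/-- The sign attached to one of the two strategies of a player. -/
def boolSign (i : Bool) : ℝ := if i then 1 else -1

/-- Two players of weights `p` and `q` with two strategies each can be made to interact so that
their gains from deviating are `± α` and `± β`, where the sign says whether the two players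
choose equally labelled strategies. -/
def Interacts (𝒞 : WCostFamily) (p q : NNReal) (α β : ℝ) : Prop :=
  ∃ m, ∃ c ∈ 𝒞 m, ∃ a : Fin m → NNReal, ∃ S T : Bool → Fin m → ℕ,
    (∀ i r, S i r ≤ 1) ∧ (∀ i r, T i r ≤ 1) ∧ ∀ i j,
      strategyCost c p (S i) (a + strategyLoad p (S i) + strategyLoad q (T j)) -
        strategyCost c p (S !i) (a + strategyLoad p (S !i) + strategyLoad q (T j)) =
          boolSign i * boolSign j * α ∧
      strategyCost c q (T j) (a + strategyLoad p (S i) + strategyLoad q (T j)) -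
        strategyCost c q (T !j) (a + strategyLoad p (S i) + strategyLoad q (T !j)) =
          boolSign i * boolSign j * β

lemma WConsistent.exists_two_player_equilibrium {𝒞 : WCostFamily} (hcons : WConsistent 𝒞)
    {m : ℕ} {c : (Fin m → NNReal) → Fin m → ℝ} (hc : c ∈ 𝒞 m) {p q : NNReal} (hp : 0 < p)
    (hq : 0 < q) (a : Fin m → NNReal) (S T : Bool → Fin m → ℕ) (hS : ∀ i r, S i r ≤ 1)
    (hT : ∀ i r, T i r ≤ 1) :
    ∃ i j,
      strategyCost c p (S i) (a + strategyLoad p (S i) + strategyLoad q (T j)) ≤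
        strategyCost c p (S !i) (a + strategyLoad p (S !i) + strategyLoad q (T j)) ∧
      strategyCost c q (T j) (a + strategyLoad p (S i) + strategyLoad q (T j)) ≤
        strategyCost c q (T !j) (a + strategyLoad p (S i) + strategyLoad q (T !j)) := by
  classical
  set f : Fin m → Fin m → ℕ := fun k => if a k = 0 then 0 else Pi.single k 1 with hf
  set w : Fin (m + 2) → NNReal :=
    Fin.cons p (Fin.cons q (fun k => if a k = 0 then 1 else a k)) with hw
  set Y : Fin (m + 2) → Finset (Fin m → ℕ) :=
    Fin.cons (univ.image S) (Fin.cons (univ.image T) (fun k => {f k})) with hY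
  have hload : ∀ u v : Fin m → ℕ, wloadVec w (Fin.cons u (Fin.cons v f)) =
      a + strategyLoad p u + strategyLoad q v := by
    intro u v
    ext r
    have hsum : ∑ k, (if a k = 0 then 1 else a k) * (f k r : NNReal) = a r := by
      rw [Finset.sum_eq_single r]
      · by_cases h : a r = 0 <;> simp [hf, h]
      · intro k _ hk
        by_cases h : a k = 0
        · simp [hf, h]
        · simp [hf, h, Ne.symm hk]
      · simp
    simp only [wloadVec, hw, Fin.sum_univ_succ, Fin.cons_zero, Fin.cons_succ, hsum]
    simp only [strategyLoad, Pi.add_apply]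
    push_cast
    ring
  have hcost0 : ∀ u v : Fin m → ℕ, wPlayerCost c w (Fin.cons u (Fin.cons v f)) 0 =
      strategyCost c p u (a + strategyLoad p u + strategyLoad q v) := by
    intro u v
    simp only [wPlayerCost, hload]
    simp [strategyCost, hw]
  have hcost1 : ∀ u v : Fin m → ℕ, wPlayerCost c w (Fin.cons u (Fin.cons v f)) (Fin.succ 0) =
      strategyCost c q v (a + strategyLoad p u + strategyLoad q v) := by
    intro u v
    simp only [wPlayerCost, hload]
    simp only [strategyCost, hw, Fin.cons_succ, Fin.cons_zero]
  obtain ⟨y, hyY, hy⟩ := hcons m c hc (m + 2) w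
    (by
      refine Fin.cases (by simpa [hw]) (Fin.cases (by simpa [hw] using hq) fun k => ?_)
      by_cases h : a k = 0
      · simp [hw, h]
      · simpa [hw, h] using pos_iff_ne_zero.2 h) Y
    (by
      constructor
      · exact Fin.cases (by simp [hY])
          (Fin.cases (by simp only [hY, Fin.cons_succ, Fin.cons_zero]; simp) fun k => by simp [hY])
      · refine Fin.cases ?_ (Fin.cases ?_ fun k => ?_)
        · intro v hv r
          simp only [hY, Fin.cons_zero, Finset.mem_image] at hv
          obtain ⟨i, -, rfl⟩ := hv
          exact hS i r
        · intro v hv r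
          simp only [hY, Fin.cons_zero, Fin.cons_succ, Finset.mem_image] at hv
          obtain ⟨i, -, rfl⟩ := hv
          exact hT i r
        · intro v hv r
          simp only [hY, Fin.cons_succ, Finset.mem_singleton] at hv
          subst hv
          by_cases h : a k = 0
          · simp [hf, h]
          · by_cases h' : r = k <;> simp [hf, h, h'])
  have h0 := hyY 0
  have h1 := hyY (Fin.succ 0)
  simp only [hY, Fin.cons_zero, Fin.cons_succ, Finset.mem_image] at h0 h1
  obtain ⟨i, -, hi⟩ := h0
  obtain ⟨j, -, hj⟩ := h1
  have hy_eq : y = Fin.cons (S i) (Fin.cons (T j) f) := by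
    funext k
    refine Fin.cases hi.symm (Fin.cases hj.symm fun l => ?_) k
    have := hyY l.succ.succ
    simp only [hY, Fin.cons_succ, Finset.mem_singleton] at this
    simpa using this
  subst hy_eq
  refine ⟨i, j, ?_, ?_⟩
  · have := hy 0 (S !i) (Finset.mem_image_of_mem S (mem_univ _))
    rwa [Fin.update_cons_zero, hcost0, hcost0] at this
  · have := hy (Fin.succ 0) (T !j) (Finset.mem_image_of_mem T (mem_univ _))
    rwa [← Fin.cons_update, Fin.update_cons_zero, hcost1, hcost1] at this

namespace Interacts

variable {𝒞 : WCostFamily} {p q : NNReal} {α β α' β' : ℝ}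

lemma mul_nonneg (hcons : WConsistent 𝒞) (hp : 0 < p) (hq : 0 < q)
    (h : Interacts 𝒞 p q α β) : 0 ≤ α * β := by
  obtain ⟨m, c, hc, a, S, T, hS, hT, hST⟩ := h
  obtain ⟨i, j, h1, h2⟩ := hcons.exists_two_player_equilibrium hc hp hq a S T hS hT
  have h3 : boolSign i * boolSign j * α ≤ 0 := by rw [← (hST i j).1]; linarith
  have h4 : boolSign i * boolSign j * β ≤ 0 := by rw [← (hST i j).2]; linarith
  have h5 := mul_nonneg_of_nonpos_of_nonpos h3 h4
  cases i <;> cases j <;> simpa [boolSign] using h5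

lemma swap (h : Interacts 𝒞 p q α β) : Interacts 𝒞 q p β α := by
  obtain ⟨m, c, hc, a, S, T, hS, hT, hST⟩ := h
  refine ⟨m, c, hc, a, T, S, hT, hS, fun i j => ?_⟩
  simp only [add_right_comm a (strategyLoad q _), mul_comm (boolSign i)]
  exact ⟨(hST j i).2, (hST j i).1⟩

lemma neg (h : Interacts 𝒞 p q α β) : Interacts 𝒞 p q (-α) (-β) := by
  obtain ⟨m, c, hc, a, S, T, hS, hT, hST⟩ := h
  refine ⟨m, c, hc, a, fun i => S !i, T, fun i => hS _, hT, fun i j => ?_⟩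
  have hsign : boolSign (!i) = -boolSign i := by cases i <;> simp [boolSign]
  have := hST (!i) j
  rw [hsign] at this
  exact ⟨this.1.trans (by ring), this.2.trans (by ring)⟩

lemma add (hcomp : WClosedUnderComposition 𝒞) (h : Interacts 𝒞 p q α β)
    (h' : Interacts 𝒞 p q α' β') : Interacts 𝒞 p q (α + α') (β + β') := by
  obtain ⟨m, c, hc, a, S, T, hS, hT, hST⟩ := h
  obtain ⟨m', c', hc', a', S', T', hS', hT', hST'⟩ := h'
  refine ⟨m + m', woplus c c', hcomp m m' c hc c' hc', Fin.append a a',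
    fun i => Fin.append (S i) (S' i), fun i => Fin.append (T i) (T' i),
    fun i => append_le_one (hS i) (hS' i), fun i => append_le_one (hT i) (hT' i),
    fun i j => ?_⟩
  simp only [strategyLoad_append, append_add_append, strategyCost_append]
  have h1 := hST i j
  have h2 := hST' i j
  constructor
  · linear_combination h1.1 + h2.1
  · linear_combination h1.2 + h2.2

lemma sub (hcomp : WClosedUnderComposition 𝒞) (h : Interacts 𝒞 p q α β)
    (h' : Interacts 𝒞 p q α' β') : Interacts 𝒞 p q (α - α') (β - β') := by
  simpa [sub_eq_add_neg] using h.add hcomp h'.neg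

/-- If the influence on the second player can be varied without changing the influence on the
first, then the first player is not influenced at all. -/
lemma eq_zero (hcomp : WClosedUnderComposition 𝒞) (hcons : WConsistent 𝒞) (hp : 0 < p)
    (hq : 0 < q) (h : Interacts 𝒞 p q 0 β) (hβ : β ≠ 0) (h' : Interacts 𝒞 p q α β') :
    α = 0 := by
  have hadd : ∀ k : ℕ, Interacts 𝒞 p q α (β' + k * β) ∧ Interacts 𝒞 p q α (β' - k * β) := by
    intro k
    induction k with
    | zero => simpa using h'
    | succ k ih =>
      constructor
      · convert ih.1.add hcomp h using 1 <;> push_cast <;> ring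
      · convert ih.2.sub hcomp h using 1 <;> push_cast <;> ring
  by_contra hα
  have hpos : 0 < |α * β| := abs_pos.2 (mul_ne_zero hα hβ)
  obtain ⟨k, hk⟩ := exists_nat_gt (α * β' / |α * β|)
  rw [div_lt_iff₀ hpos] at hk
  have h1 := (hadd k).1.mul_nonneg hcons hp hq
  have h2 := (hadd k).2.mul_nonneg hcons hp hq
  rcases abs_choice (α * β) with h3 | h3 <;> rw [h3] at hk <;> nlinarith

/-- The interaction of two players who may use or not use the resources selected by `z` and `z'`
respectively. -/
lemma of_strategies (hcomp : WClosedUnderComposition 𝒞) {m : ℕ}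
    {c : (Fin m → NNReal) → Fin m → ℝ} (hc : c ∈ 𝒞 m) (p q : NNReal) (a : Fin m → NNReal)
    {z z' : Fin m → ℕ} (hz : ∀ r, z r ≤ 1) (hz' : ∀ r, z' r ≤ 1) :
    Interacts 𝒞 p q
      (strategyCost c p z (a + strategyLoad p z + strategyLoad q z') -
        strategyCost c p z (a + strategyLoad p z))
      (strategyCost c q z' (a + strategyLoad p z + strategyLoad q z') -
        strategyCost c q z' (a + strategyLoad q z')) := by
  refine ⟨m + m, woplus c c, hcomp m m c hc c hc, Fin.append a a,
    fun i => Fin.append (if i then z else 0) (if i then 0 else z),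
    fun i => Fin.append (if i then z' else 0) (if i then 0 else z'),
    fun i => append_le_one (by cases i <;> simp [hz]) (by cases i <;> simp [hz]),
    fun i => append_le_one (by cases i <;> simp [hz']) (by cases i <;> simp [hz']),
    fun i j => ?_⟩
  simp only [strategyLoad_append, append_add_append, strategyCost_append]
  cases i <;> cases j <;>
    simp [boolSign, strategyLoad_zero, strategyCost_zero]

end Interacts

/-- The change of the cost of `s` when the load of `t` is increased by `q`. -/
def crossEffect {m : ℕ} (c : (Fin m → NNReal) → Fin m → ℝ) (s t : Fin m) (q : NNReal)
    (x : Fin m → NNReal) : ℝ :=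
  c (x + Pi.single t q) s - c x s

lemma exists_eq_add_single {m : ℕ} {w : NNReal} {s : Fin m} {x : Fin m → NNReal}
    (hx : w ≤ x s) : ∃ a : Fin m → NNReal, x = a + Pi.single s w := by
  have hle : Pi.single s w ≤ x := by
    intro k
    by_cases h : k = s
    · subst h; simpa using hx
    · simp [h]
  exact ⟨x - Pi.single s w, (tsub_add_cancel_of_le hle).symm⟩

section CrossEffects

variable {𝒞 : WCostFamily} {m : ℕ} {c : (Fin m → NNReal) → Fin m → ℝ}

lemma interacts_mixed_difference (hcomp : WClosedUnderComposition 𝒞)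
    (hc : c ∈ 𝒞 m) (p q : NNReal) (a : Fin m → NNReal) (r : Fin m) {s t : Fin m}
    (hst : s ≠ t) :
    Interacts 𝒞 p q 0
      (q * (crossEffect c s t q (a + Pi.single s q + Pi.single r p) -
        crossEffect c s t q (a + Pi.single s q))) := by
  have htwo : ∀ l, (Pi.single s 1 + Pi.single t 1 : Fin m → ℕ) l ≤ 1 := by
    intro l
    by_cases h : l = s
    · subst h; simp [hst]
    · simpa [h] using single_one_le_one t l
  have h1 := Interacts.of_strategies hcomp hc p q a (single_one_le_one r) htwo
  have h2 := Interacts.of_strategies hcomp hc p q (a + Pi.single s q) (single_one_le_one r)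
    (single_one_le_one t)
  have h3 := Interacts.of_strategies hcomp hc p q a (single_one_le_one r) (single_one_le_one s)
  simp only [strategyLoad_add, strategyLoad_single, strategyCost_add,
    strategyCost_single] at h1 h2 h3
  convert (h1.sub hcomp h2).sub hcomp h3 using 1
  · simp only [add_comm, add_left_comm]
    ring
  · simp only [crossEffect, add_comm, add_left_comm]
    ring

lemma crossEffect_add_single_of_le (hcomp : WClosedUnderComposition 𝒞)
    (hcons : WConsistent 𝒞) (hc : c ∈ 𝒞 m) {w : NNReal} (hw : 0 < w) (r : Fin m) {s t : Fin m}
    (hst : s ≠ t) {x : Fin m → NNReal} (hx : w ≤ x s) :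
    crossEffect c s t w (x + Pi.single r w) = crossEffect c s t w x := by
  obtain ⟨a, rfl⟩ := exists_eq_add_single hx
  have h := interacts_mixed_difference hcomp hc w w a r hst
  by_contra hne
  have hne' : (w : ℝ) * (crossEffect c s t w (a + Pi.single s w + Pi.single r w) -
      crossEffect c s t w (a + Pi.single s w)) ≠ 0 :=
    mul_ne_zero (by exact_mod_cast hw.ne') (sub_ne_zero.2 hne)
  exact hne' (h.eq_zero hcomp hcons hw hw hne' h.swap)

lemma crossEffect_nat_mul_add_single_self_of_le (hcomp : WClosedUnderComposition 𝒞)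
    (hcons : WConsistent 𝒞) (hc : c ∈ 𝒞 m) {w : NNReal} (hw : 0 < w) {s t : Fin m}
    (hst : s ≠ t) (N : ℕ) {x : Fin m → NNReal} (hx : w ≤ x s) :
    crossEffect c s t (N * w) (x + Pi.single s w) = crossEffect c s t (N * w) x := by
  induction N with
  | zero => simp [crossEffect]
  | succ N ih =>
    have h := crossEffect_add_single_of_le hcomp hcons hc hw s hst
      (x := x + Pi.single t (N * w)) (by simpa [hst] using hx)
    have hsplit : (Pi.single t (((N + 1 : ℕ) : NNReal) * w) : Fin m → NNReal) =
        Pi.single t (N * w) + Pi.single t w := by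
      rw [← Pi.single_add]; congr 1; push_cast; ring
    simp only [crossEffect, hsplit, ← add_assoc] at ih h ⊢
    simp only [add_right_comm x _ (Pi.single s w)] at ih h ⊢
    linarith

lemma crossEffect_add_single_nat_mul {v w : NNReal} {s t : Fin m} {b : NNReal}
    (h : ∀ x : Fin m → NNReal, b ≤ x s →
      crossEffect c s t w (x + Pi.single s v) = crossEffect c s t w x) (N : ℕ)
    {x : Fin m → NNReal} (hx : b ≤ x s) :
    crossEffect c s t w (x + Pi.single s (N * v)) = crossEffect c s t w x := by
  induction N with
  | zero => simp
  | succ N ih =>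
    have hsplit : (Pi.single s (((N + 1 : ℕ) : NNReal) * v) : Fin m → NNReal) =
        Pi.single s (N * v) + Pi.single s v := by
      rw [← Pi.single_add]; congr 1; push_cast; ring
    rw [hsplit, ← add_assoc, h _ (by simpa using le_add_right hx), ih]

lemma crossEffect_add_single_self_nat_mul (hcomp : WClosedUnderComposition 𝒞)
    (hcons : WConsistent 𝒞) (hc : c ∈ 𝒞 m) {w : NNReal} (hw : 0 < w) {s t : Fin m} (hst : s ≠ t)
    {x : Fin m → NNReal} (hx : 0 < x s) (K : ℕ) :
    crossEffect c s t w (x + Pi.single s (K * w)) = crossEffect c s t w x := by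
  obtain ⟨N, hN⟩ := exists_nat_gt (w / x s)
  have hN0 : (0 : NNReal) < N := lt_of_le_of_lt zero_le hN
  have hle : w / N ≤ x s := by
    rw [div_lt_iff₀ hx] at hN
    rw [div_le_iff₀ hN0, mul_comm]
    exact hN.le
  have hmul : (N : NNReal) * (w / N) = w := mul_div_cancel₀ _ hN0.ne'
  have h := fun y hy => crossEffect_nat_mul_add_single_self_of_le hcomp hcons hc
    (div_pos hw hN0) hst N (x := y) hy
  rw [hmul] at h
  have h' := crossEffect_add_single_nat_mul h (K * N) hle
  rwa [Nat.cast_mul, mul_assoc, hmul] at h'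

lemma crossEffect_add_single (hcomp : WClosedUnderComposition 𝒞)
    (hcons : WConsistent 𝒞) (hc : c ∈ 𝒞 m) {p q : NNReal} (hp : 0 < p) (hq : 0 < q) (r : Fin m)
    {s t : Fin m} (hst : s ≠ t) {x : Fin m → NNReal} (hx : 0 < x s) :
    crossEffect c s t q (x + Pi.single r p) = crossEffect c s t q x := by
  have hle : ∀ x : Fin m → NNReal, q ≤ x s →
      crossEffect c s t q (x + Pi.single r p) = crossEffect c s t q x := by
    intro x hx
    obtain ⟨a, rfl⟩ := exists_eq_add_single hx
    by_contra hne
    have hne' : (q : ℝ) * (crossEffect c s t q (a + Pi.single s q + Pi.single r p) -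
        crossEffect c s t q (a + Pi.single s q)) ≠ 0 :=
      mul_ne_zero (by exact_mod_cast hq.ne') (sub_ne_zero.2 hne)
    have hvanish : ∀ y : Fin m → NNReal, p ≤ y s → crossEffect c s t q y = 0 := by
      intro y hy
      obtain ⟨b, rfl⟩ := exists_eq_add_single hy
      have h := (interacts_mixed_difference hcomp hc p q a r hst).eq_zero hcomp hcons hp hq hne'
        (Interacts.of_strategies hcomp hc p q b (single_one_le_one s) (single_one_le_one t))
      simp only [strategyLoad_single, strategyCost_single, ← mul_sub] at h
      exact (mul_eq_zero.1 h).resolve_left (by exact_mod_cast hp.ne')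
    have hzero : ∀ y : Fin m → NNReal, 0 < y s → crossEffect c s t q y = 0 := by
      intro y hy
      obtain ⟨K, hK⟩ := exists_nat_gt (p / q)
      rw [div_lt_iff₀ hq] at hK
      rw [← crossEffect_add_single_self_nat_mul hcomp hcons hc hq hst hy K]
      exact hvanish _ (by simpa using le_add_left hK.le)
    have hs : 0 < (a + Pi.single s q : Fin m → NNReal) s := lt_of_lt_of_le hq hx
    exact hne (by rw [hzero _ hs, hzero _ (lt_of_lt_of_le hs (by simp))])
  have hself := fun (y : Fin m → NNReal) (hy : 0 < y s) =>
    crossEffect_add_single_self_nat_mul hcomp hcons hc hq hst hy 1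
  simp only [Nat.cast_one, one_mul] at hself
  rw [← hself x hx, ← hself _ (lt_of_lt_of_le hx (by simp)), add_right_comm]
  exact hle _ (by simp)

lemma crossEffect_add (hcomp : WClosedUnderComposition 𝒞)
    (hcons : WConsistent 𝒞) (hc : c ∈ 𝒞 m) {q : NNReal} (hq : 0 < q) {s t : Fin m} (hst : s ≠ t)
    {x : Fin m → NNReal} (hx : 0 < x s) (y : Fin m → NNReal) :
    crossEffect c s t q (x + y) = crossEffect c s t q x := by
  suffices h : ∀ A : Finset (Fin m),
      crossEffect c s t q (x + ∑ r ∈ A, Pi.single r (y r)) = crossEffect c s t q x by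
    simpa [Finset.univ_sum_single] using h univ
  intro A
  induction A using Finset.induction_on with
  | empty => simp
  | insert r A hr ih =>
    rw [Finset.sum_insert hr, add_comm (Pi.single r _), ← add_assoc]
    rcases eq_or_ne (y r) 0 with h0 | h0
    · simpa [h0] using ih
    · rw [crossEffect_add_single hcomp hcons hc (pos_iff_ne_zero.2 h0) hq r hst, ih]
      exact lt_of_lt_of_le hx (by simp)

end CrossEffects

/-- Lemma (part (b)): the effect of an additional load of `ε` on resource `s` on the
cost of resource `r` does not depend on the load vector, for weighted consistency. -/
theorem diagonal_hesse_weighted (𝒞 : WCostFamily)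
    (hcomp : WClosedUnderComposition 𝒞) (hcons : WConsistent 𝒞)
    (m : ℕ) (c : (Fin m → NNReal) → Fin m → ℝ) (hc : c ∈ 𝒞 m)
    (r s : Fin m) (hrs : r ≠ s) (x y : Fin m → NNReal)
    (hx : 0 < x r) (hy : 0 < y r) (ε : NNReal) (hε : 0 < ε) :
    c (x + ε • nindicVec {s}) r - c x r = c (y + ε • nindicVec {s}) r - c y r := by
  have hsingle : ε • nindicVec {s} = (Pi.single s ε : Fin m → NNReal) := by
    ext k
    by_cases h : k = s <;> simp [nindicVec, h]
  have h1 := crossEffect_add hcomp hcons hc hε hrs hx y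
  have h2 := crossEffect_add hcomp hcons hc hε hrs hy x
  rw [add_comm y x] at h2
  rw [hsingle]
  exact h1.symm.trans h2
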